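/- Let P be a finite set of points in ℝ^d whose affine hull is all of ℝ^d, let ω : P → [0,∞) be a weight assignment, and let p ∈ P be a point whose weighted Voronoi cell Vor_ω(p) is bounded. If every d-simplex of the weighted Delaunay complex Del_ω(P) containing p is δ²-power protected for some δ > 0, then every j-simplex of Del_ω(P) containing p is (δ²/(d − j + 1))-power protected. -/

import Mathlib

noncomputable section

/-- Weighted Voronoi cell of `p` among the points of `P`:
all points whose power distance to `p` is at most the power distance to any other point of `P`. -/
def vorCell {d : ℕ} (P : Finset (EuclideanSpace ℝ (Fin d))) (ω : EuclideanSpace ℝ (Fin d) → ℝ)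
    (p : EuclideanSpace ℝ (Fin d)) : Set (EuclideanSpace ℝ (Fin d)) :=
  {x | ∀ q ∈ P, ‖x - p‖ ^ 2 - ω p ^ 2 ≤ ‖x - q‖ ^ 2 - ω q ^ 2}

/-- Weighted Voronoi face of a simplex `σ`. -/
def vorFace {d : ℕ} (P : Finset (EuclideanSpace ℝ (Fin d))) (ω : EuclideanSpace ℝ (Fin d) → ℝ)
    (σ : Finset (EuclideanSpace ℝ (Fin d))) : Set (EuclideanSpace ℝ (Fin d)) :=
  ⋂ p ∈ σ, vorCell P ω p

/-- `σ` is `δ²`-power protected at `c`. -/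
def powerProtectedAt {d : ℕ} (P : Finset (EuclideanSpace ℝ (Fin d)))
    (ω : EuclideanSpace ℝ (Fin d) → ℝ) (σ : Finset (EuclideanSpace ℝ (Fin d)))
    (c : EuclideanSpace ℝ (Fin d)) (δsq : ℝ) : Prop :=
  ∀ q ∈ P, q ∉ σ → ∀ p ∈ σ, ‖p - c‖ ^ 2 - ω p ^ 2 + δsq < ‖q - c‖ ^ 2 - ω q ^ 2

open Filter Topology

/-- Excess of the power distance to `q` over the power distance to `p`. -/
def powerGap {d : ℕ} (ω : EuclideanSpace ℝ (Fin d) → ℝ) (p q x : EuclideanSpace ℝ (Fin d)) : ℝ :=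
  (‖x - q‖ ^ 2 - ω q ^ 2) - (‖x - p‖ ^ 2 - ω p ^ 2)

lemma powerGap_eq {d : ℕ} (ω : EuclideanSpace ℝ (Fin d) → ℝ) (p q x : EuclideanSpace ℝ (Fin d)) :
    powerGap ω p q x =
      (‖q‖ ^ 2 - ω q ^ 2 - ‖p‖ ^ 2 + ω p ^ 2) + 2 * inner ℝ (p - q) x := by
  unfold powerGap
  rw [norm_sub_sq_real, norm_sub_sq_real, inner_sub_left, real_inner_comm x p,
    real_inner_comm x q]
  ring

lemma powerGap_add_smul {d : ℕ} (ω : EuclideanSpace ℝ (Fin d) → ℝ)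
    (p q x u : EuclideanSpace ℝ (Fin d)) (t : ℝ) :
    powerGap ω p q (x + t • u) = powerGap ω p q x + t * (2 * inner ℝ (p - q) u) := by
  rw [powerGap_eq, powerGap_eq, inner_add_right, inner_smul_right]
  ring

lemma powerGap_combo {d : ℕ} (ω : EuclideanSpace ℝ (Fin d) → ℝ)
    (p q x y : EuclideanSpace ℝ (Fin d)) {a b : ℝ} (hab : a + b = 1) :
    powerGap ω p q (a • x + b • y) = a * powerGap ω p q x + b * powerGap ω p q y := by
  simp only [powerGap_eq, inner_add_right, inner_smul_right]
  linear_combination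
    (-(‖q‖ ^ 2 - ω q ^ 2 - ‖p‖ ^ 2 + ω p ^ 2)) * hab

lemma powerGap_average {d : ℕ} (ω : EuclideanSpace ℝ (Fin d) → ℝ)
    (p q x : EuclideanSpace ℝ (Fin d)) {ι : Type*} (s : Finset ι)
    (y : ι → EuclideanSpace ℝ (Fin d)) :
    powerGap ω p q (((s.card : ℝ) + 1)⁻¹ • (x + ∑ i ∈ s, y i)) =
      (powerGap ω p q x + ∑ i ∈ s, powerGap ω p q (y i)) / ((s.card : ℝ) + 1) := by
  have h : (s.card : ℝ) + 1 ≠ 0 := by positivity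
  simp only [powerGap_eq, inner_add_right, inner_smul_right, inner_sum, Finset.sum_add_distrib,
    Finset.sum_const, nsmul_eq_mul, ← Finset.mul_sum]
  field_simp
  ring

lemma continuous_powerGap {d : ℕ} (ω : EuclideanSpace ℝ (Fin d) → ℝ)
    (p q : EuclideanSpace ℝ (Fin d)) : Continuous (powerGap ω p q) := by
  unfold powerGap
  fun_prop

lemma mem_vorFace_iff {d : ℕ} {P : Finset (EuclideanSpace ℝ (Fin d))}
    {ω : EuclideanSpace ℝ (Fin d) → ℝ} {σ : Finset (EuclideanSpace ℝ (Fin d))}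
    {p : EuclideanSpace ℝ (Fin d)} (hσP : σ ⊆ P) (hp : p ∈ σ) (x : EuclideanSpace ℝ (Fin d)) :
    x ∈ vorFace P ω σ ↔
      (∀ q ∈ σ, powerGap ω p q x = 0) ∧ ∀ q ∈ P, 0 ≤ powerGap ω p q x := by
  simp only [vorFace, vorCell, Set.mem_iInter, Set.mem_ofPred_eq, powerGap]
  constructor
  · intro h
    exact ⟨fun q hq => by linarith [h q hq p (hσP hp), h p hp q (hσP hq)],
      fun q hq => by linarith [h p hp q hq]⟩
  · rintro ⟨h₁, h₂⟩ r hr q hq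
    linarith [h₁ r hr, h₂ q hq]

lemma powerProtectedAt_iff {d : ℕ} {P : Finset (EuclideanSpace ℝ (Fin d))}
    {ω : EuclideanSpace ℝ (Fin d) → ℝ} {σ : Finset (EuclideanSpace ℝ (Fin d))}
    {p : EuclideanSpace ℝ (Fin d)} (hσP : σ ⊆ P) (hp : p ∈ σ) {x : EuclideanSpace ℝ (Fin d)}
    (hx : x ∈ vorFace P ω σ) (ε : ℝ) :
    powerProtectedAt P ω σ x ε ↔ ∀ q ∈ P, q ∉ σ → ε < powerGap ω p q x := by
  rw [mem_vorFace_iff hσP hp] at hx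
  simp only [powerProtectedAt, norm_sub_rev _ x]
  constructor
  · intro h q hq hqσ
    have := h q hq hqσ p hp
    unfold powerGap
    linarith
  · intro h q hq hqσ r hr
    have h₁ := h q hq hqσ
    have h₂ := hx.1 r hr
    unfold powerGap at h₁ h₂
    linarith

lemma convex_vorFace {d : ℕ} {P : Finset (EuclideanSpace ℝ (Fin d))}
    {ω : EuclideanSpace ℝ (Fin d) → ℝ} {σ : Finset (EuclideanSpace ℝ (Fin d))}
    {p : EuclideanSpace ℝ (Fin d)} (hσP : σ ⊆ P) (hp : p ∈ σ) : Convex ℝ (vorFace P ω σ) := by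
  intro x hx y hy a b ha hb hab
  rw [mem_vorFace_iff hσP hp] at hx hy ⊢
  refine ⟨fun q hq => ?_, fun q hq => ?_⟩
  · rw [powerGap_combo _ _ _ _ _ hab, hx.1 q hq, hy.1 q hq]
    simp
  · rw [powerGap_combo _ _ _ _ _ hab]
    have := hx.2 q hq
    have := hy.2 q hq
    positivity

lemma isCompact_vorFace {d : ℕ} {P : Finset (EuclideanSpace ℝ (Fin d))}
    {ω : EuclideanSpace ℝ (Fin d) → ℝ} {σ : Finset (EuclideanSpace ℝ (Fin d))}
    {p : EuclideanSpace ℝ (Fin d)} (hp : p ∈ σ)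
    (hbdd : Bornology.IsBounded (vorCell P ω p)) : IsCompact (vorFace P ω σ) := by
  refine Metric.isCompact_of_isClosed_isBounded ?_ (hbdd.subset (Set.biInter_subset_of_mem hp))
  refine isClosed_biInter fun r _ => ?_
  simp only [vorCell, Set.ofPred_forall]
  exact isClosed_biInter fun q _ => isClosed_le (by fun_prop) (by fun_prop)

/-- Moving a little from a point of a cell in a direction that does not leave any active
half-space stays in the cell. -/
lemma eventually_powerGap_nonneg {d : ℕ} {P : Finset (EuclideanSpace ℝ (Fin d))}
    {ω : EuclideanSpace ℝ (Fin d) → ℝ} {p x u : EuclideanSpace ℝ (Fin d)}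
    (hx : ∀ q ∈ P, 0 ≤ powerGap ω p q x)
    (hu : ∀ q ∈ P, powerGap ω p q x = 0 → 0 ≤ inner ℝ (p - q) u) :
    ∀ᶠ t : ℝ in 𝓝[>] 0, ∀ q ∈ P, 0 ≤ powerGap ω p q (x + t • u) := by
  rw [Filter.eventually_all_finset]
  intro q hq
  rcases (hx q hq).eq_or_lt with h | h
  · filter_upwards [self_mem_nhdsWithin] with t ht
    have := hu q hq h.symm
    have ht : (0 : ℝ) < t := ht
    rw [powerGap_add_smul, ← h]
    positivity
  · have hc : Continuous fun t : ℝ => powerGap ω p q (x + t • u) :=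
      (continuous_powerGap ω p q).comp (by fun_prop)
    have := (hc.tendsto 0).eventually_const_lt (u := 0) (by simpa using h)
    exact (this.filter_mono nhdsWithin_le_nhds).mono fun t ht => ht.le

/-- At an extreme point of a face, the active constraints determine the point. -/
lemma eq_zero_of_mem_extremePoints {d : ℕ} {P : Finset (EuclideanSpace ℝ (Fin d))}
    {ω : EuclideanSpace ℝ (Fin d) → ℝ} {σ : Finset (EuclideanSpace ℝ (Fin d))}
    {p : EuclideanSpace ℝ (Fin d)} (hσP : σ ⊆ P) (hp : p ∈ σ) {x u : EuclideanSpace ℝ (Fin d)}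
    (hx : x ∈ (vorFace P ω σ).extremePoints ℝ)
    (hu : ∀ q ∈ P, powerGap ω p q x = 0 → inner ℝ (p - q) u = 0) : u = 0 := by
  have hx₀ := (mem_vorFace_iff hσP hp x).1 hx.1
  have h₁ := eventually_powerGap_nonneg hx₀.2 fun q hq h => (hu q hq h).ge
  have h₂ := eventually_powerGap_nonneg (u := -u) hx₀.2 fun q hq h => by
    rw [inner_neg_right, hu q hq h, neg_zero]
  obtain ⟨t, ⟨h₁, h₂⟩, ht⟩ := ((h₁.and h₂).and self_mem_nhdsWithin).exists
  have ht : (0 : ℝ) < t := ht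
  have m₁ : x + t • u ∈ vorFace P ω σ := by
    refine (mem_vorFace_iff hσP hp _).2 ⟨fun q hq => ?_, h₁⟩
    rw [powerGap_add_smul, hx₀.1 q hq, hu q (hσP hq) (hx₀.1 q hq)]
    ring
  have m₂ : x + t • (-u) ∈ vorFace P ω σ := by
    refine (mem_vorFace_iff hσP hp _).2 ⟨fun q hq => ?_, h₂⟩
    rw [powerGap_add_smul, hx₀.1 q hq, inner_neg_right, hu q (hσP hq) (hx₀.1 q hq)]
    ring
  have hseg : x ∈ openSegment ℝ (x + t • u) (x + t • (-u)) :=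
    ⟨1 / 2, 1 / 2, by norm_num, by norm_num, by norm_num, by module⟩
  have := hx.2 m₁ m₂ hseg
  have : t • u = 0 := by simpa using this
  exact (smul_eq_zero.1 this).resolve_left ht.ne'

/-- A finite set whose differences from `p` separate vectors contains a full-dimensional simplex
with vertex `p` having the same property. -/
lemma exists_simplex_of_separating {d : ℕ} {S : Finset (EuclideanSpace ℝ (Fin d))}
    {p : EuclideanSpace ℝ (Fin d)} (hp : p ∈ S)
    (hS : ∀ u, (∀ q ∈ S, inner ℝ (p - q) u = 0) → u = 0) :
    ∃ τ ⊆ S, p ∈ τ ∧ τ.card = d + 1 ∧ ∀ u, (∀ q ∈ τ, inner ℝ (p - q) u = 0) → u = 0 := by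
  classical
  obtain ⟨b, hbS, hspan, hli⟩ :=
    exists_linearIndependent ℝ ((fun q => p - q) '' (S : Set (EuclideanSpace ℝ (Fin d))))
  have htop : Submodule.span ℝ b = ⊤ := by
    rw [hspan, ← Submodule.orthogonal_eq_bot_iff, Submodule.eq_bot_iff]
    intro u hu
    refine hS u fun q hq => ?_
    exact (Submodule.mem_orthogonal _ _).1 hu _ (Submodule.subset_span ⟨q, hq, rfl⟩)
  have hfin : b.Finite := (S.finite_toSet.image _).subset hbS
  lift b to Finset (EuclideanSpace ℝ (Fin d)) using hfin
  have hcard : b.card = d := by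
    have := finrank_span_finset_eq_card (R := ℝ) hli
    rw [htop, finrank_top, finrank_euclideanSpace_fin] at this
    exact this.symm
  have h0 : (0 : EuclideanSpace ℝ (Fin d)) ∉ b := fun h => hli.ne_zero ⟨0, h⟩ rfl
  refine ⟨insert p (b.image fun v => p - v), ?_, Finset.mem_insert_self _ _, ?_, ?_⟩
  · refine Finset.insert_subset hp fun q hq => ?_
    obtain ⟨v, hv, rfl⟩ := Finset.mem_image.1 hq
    obtain ⟨r, hr, rfl⟩ := hbS hv
    simpa using hr
  · rw [Finset.card_insert_of_notMem, Finset.card_image_of_injective, hcard]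
    · exact sub_right_injective
    · intro h
      obtain ⟨v, hv, hv'⟩ := Finset.mem_image.1 h
      exact h0 ((sub_eq_self.1 hv') ▸ hv)
  · intro u hu
    have : u ∈ (Submodule.span ℝ (b : Set (EuclideanSpace ℝ (Fin d))))ᗮ := by
      rw [Submodule.mem_orthogonal]
      intro v hv
      induction hv using Submodule.span_induction with
      | mem v hv =>
        simpa using hu (p - v) (Finset.mem_insert_of_mem (Finset.mem_image_of_mem _ hv))
      | zero => simp
      | add v w _ _ hv hw => rw [inner_add_left, hv, hw, add_zero]
      | smul a v _ hv => rw [real_inner_smul_left, hv, mul_zero]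
    simpa [htop] using this

/-- Relaxing one facet of a full-dimensional simplex at `p` leaves an edge direction. -/
lemma exists_edge_direction {d : ℕ} {τ : Finset (EuclideanSpace ℝ (Fin d))}
    {p q₀ : EuclideanSpace ℝ (Fin d)} (hp : p ∈ τ) (hcard : τ.card = d + 1)
    (hτ : ∀ u, (∀ q ∈ τ, inner ℝ (p - q) u = 0) → u = 0) (hq₀ : q₀ ∈ τ) (hne : q₀ ≠ p) :
    ∃ u, 0 < inner ℝ (p - q₀) u ∧ ∀ q ∈ τ, q ≠ q₀ → inner ℝ (p - q) u = 0 := by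
  classical
  set B : Finset (EuclideanSpace ℝ (Fin d)) := ((τ.erase p).erase q₀).image fun q => p - q
  have hlt : B.card < d := by
    have h₁ : B.card ≤ ((τ.erase p).erase q₀).card := Finset.card_image_le
    have h₂ := Finset.card_erase_add_one (Finset.mem_erase.2 ⟨hne, hq₀⟩)
    have h₃ := Finset.card_erase_add_one hp
    omega
  have hK : (Submodule.span ℝ (B : Set (EuclideanSpace ℝ (Fin d))))ᗮ ≠ ⊥ := by
    rw [Ne, Submodule.orthogonal_eq_bot_iff]
    intro h
    have := finrank_span_finset_le_card (R := ℝ) B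
    rw [Set.finrank, h, finrank_top, finrank_euclideanSpace_fin] at this
    omega
  obtain ⟨u, hu, hu0⟩ := Submodule.exists_mem_ne_zero_of_ne_bot hK
  have horth : ∀ q ∈ τ, q ≠ q₀ → inner ℝ (p - q) u = 0 := by
    intro q hq hqq
    by_cases hqp : q = p
    · simp [hqp]
    · refine (Submodule.mem_orthogonal _ _).1 hu _ (Submodule.subset_span ?_)
      exact Finset.mem_image_of_mem (fun q => p - q)
        (Finset.mem_erase.2 ⟨hqq, Finset.mem_erase.2 ⟨hqp, hq⟩⟩)
  have hne0 : inner ℝ (p - q₀) u ≠ 0 := by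
    intro h
    refine hu0 (hτ u fun q hq => ?_)
    by_cases hqq : q = q₀
    · rw [hqq, h]
    · exact horth q hq hqq
  rcases hne0.lt_or_gt with h | h
  · refine ⟨-u, by rw [inner_neg_right]; linarith, fun q hq hqq => ?_⟩
    rw [inner_neg_right, horth q hq hqq, neg_zero]
  · exact ⟨u, h, horth⟩

/-- If the `d`-simplices at `p` are protected, then each extreme point of a face of the cell of `p`
is the center of exactly one `d`-simplex, and all other points are far in power distance. -/
lemma exists_simplex_of_mem_extremePoints {d : ℕ} {P : Finset (EuclideanSpace ℝ (Fin d))}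
    {ω : EuclideanSpace ℝ (Fin d) → ℝ} {p : EuclideanSpace ℝ (Fin d)} {ε : ℝ}
    (hprot : ∀ σ : Finset (EuclideanSpace ℝ (Fin d)), σ ⊆ P → p ∈ σ → σ.card = d + 1 →
      (vorFace P ω σ).Nonempty → ∃ c ∈ vorFace P ω σ, powerProtectedAt P ω σ c ε)
    {σ : Finset (EuclideanSpace ℝ (Fin d))} (hσP : σ ⊆ P) (hp : p ∈ σ)
    {x : EuclideanSpace ℝ (Fin d)} (hx : x ∈ (vorFace P ω σ).extremePoints ℝ) :
    ∃ τ ⊆ P, p ∈ τ ∧ τ.card = d + 1 ∧ (∀ u, (∀ q ∈ τ, inner ℝ (p - q) u = 0) → u = 0) ∧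
      (∀ q ∈ τ, powerGap ω p q x = 0) ∧ ∀ q ∈ P, q ∉ τ → ε < powerGap ω p q x := by
  classical
  have hx₀ := (mem_vorFace_iff hσP hp x).1 hx.1
  obtain ⟨τ, hτS, hpτ, hcard, hτ⟩ := exists_simplex_of_separating
    (S := P.filter fun q => powerGap ω p q x = 0) (p := p)
    (Finset.mem_filter.2 ⟨hσP hp, hx₀.1 p hp⟩) fun u hu =>
      eq_zero_of_mem_extremePoints hσP hp hx fun q hq h => hu q (Finset.mem_filter.2 ⟨hq, h⟩)
  have hτP : τ ⊆ P := hτS.trans (Finset.filter_subset _ _)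
  have hτ0 : ∀ q ∈ τ, powerGap ω p q x = 0 := fun q hq => (Finset.mem_filter.1 (hτS hq)).2
  have hxτ : x ∈ vorFace P ω τ := (mem_vorFace_iff hτP hpτ x).2 ⟨hτ0, hx₀.2⟩
  obtain ⟨c, hc, hcp⟩ := hprot τ hτP hpτ hcard ⟨x, hxτ⟩
  have hcx : c = x := by
    refine sub_eq_zero.1 (hτ (c - x) fun q hq => ?_)
    have h₁ := ((mem_vorFace_iff hτP hpτ c).1 hc).1 q hq
    have h₂ := hτ0 q hq
    rw [powerGap_eq] at h₁ h₂
    rw [inner_sub_right]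
    linarith
  subst hcx
  exact ⟨τ, hτP, hpτ, hcard, hτ, hτ0, (powerProtectedAt_iff hτP hpτ hxτ ε).1 hcp⟩

/-- If all `d`-simplices of `Del_ω(P)` incident to `p` are `δ²`-power protected and
`Vor_ω(p)` is bounded, then every `j`-simplex incident to `p` is
`δ²/(d-j+1)`-power protected. -/
theorem power_protection_of_lower_dim_simplices
    (d : ℕ) (P : Finset (EuclideanSpace ℝ (Fin d)))
    (ω : EuclideanSpace ℝ (Fin d) → ℝ) (hω : ∀ q ∈ P, 0 ≤ ω q)
    (hspan : affineSpan ℝ (P : Set (EuclideanSpace ℝ (Fin d))) = ⊤)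
    (p : EuclideanSpace ℝ (Fin d)) (hp : p ∈ P)
    (hbdd : Bornology.IsBounded (vorCell P ω p))
    (δ : ℝ) (hδ : 0 < δ)
    (hprot : ∀ σ : Finset (EuclideanSpace ℝ (Fin d)), σ ⊆ P → p ∈ σ → σ.card = d + 1 →
      (vorFace P ω σ).Nonempty → ∃ c ∈ vorFace P ω σ, powerProtectedAt P ω σ c (δ ^ 2))
    (j : ℕ) (hj : j ≤ d)
    (σ : Finset (EuclideanSpace ℝ (Fin d))) (hσP : σ ⊆ P) (hpσ : p ∈ σ)
    (hcard : σ.card = j + 1) (hne : (vorFace P ω σ).Nonempty) :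
    ∃ c ∈ vorFace P ω σ, powerProtectedAt P ω σ c (δ ^ 2 / ((d : ℝ) - j + 1)) := by
  classical
  have hcomp := isCompact_vorFace hpσ hbdd
  have hconv := convex_vorFace (ω := ω) hσP hpσ
  obtain ⟨x, hx⟩ := hcomp.extremePoints_nonempty hne
  have hx₀ := (mem_vorFace_iff hσP hpσ x).1 hx.1
  obtain ⟨τ, hτP, hpτ, hτcard, hτ, hτ0, hτprot⟩ :=
    exists_simplex_of_mem_extremePoints hprot hσP hpσ hx
  have hδ2 : 0 < δ ^ 2 := by positivity
  have hστ : σ ⊆ τ := by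
    intro q hq
    by_contra h
    linarith [hτprot q (hσP hq) h, hx₀.1 q hq]
  have hvert : ∀ q ∈ τ \ σ, ∃ y ∈ vorFace P ω σ, δ ^ 2 < powerGap ω p q y := by
    intro q hq
    obtain ⟨hqτ, hqσ⟩ := Finset.mem_sdiff.1 hq
    obtain ⟨u, hu, hu0⟩ :=
      exists_edge_direction hpτ hτcard hτ hqτ (fun h => hqσ (h ▸ hpσ))
    have hex : ∃ y ∈ (vorFace P ω σ).extremePoints ℝ, powerGap ω p q y ≠ 0 := by
      by_contra! hall
      have hsub : vorFace P ω σ ⊆ {y | powerGap ω p q y = 0} := by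
        rw [← closure_convexHull_extremePoints hcomp hconv]
        refine closure_minimal (convexHull_min hall ?_)
          (isClosed_eq (continuous_powerGap ω p q) continuous_const)
        intro y hy z hz a b _ _ hab
        simp only [Set.mem_ofPred_eq] at hy hz ⊢
        rw [powerGap_combo _ _ _ _ _ hab, hy, hz]
        ring
      have hev := eventually_powerGap_nonneg (u := u) hx₀.2 fun r hr hr0 => by
        by_cases hrq : r = q
        · exact hrq ▸ hu.le
        · refine (hu0 r ?_ hrq).ge
          by_contra h
          linarith [hτprot r hr h]
      obtain ⟨t, ht', ht⟩ := (hev.and self_mem_nhdsWithin).exists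
      have ht : (0 : ℝ) < t := ht
      have hmem : x + t • u ∈ vorFace P ω σ := by
        refine (mem_vorFace_iff hσP hpσ _).2 ⟨fun r hr => ?_, ht'⟩
        rw [powerGap_add_smul, hx₀.1 r hr, hu0 r (hστ hr) (fun h => hqσ (h ▸ hr))]
        ring
      have h0 : powerGap ω p q (x + t • u) = 0 := hsub hmem
      rw [powerGap_add_smul, hτ0 q hqτ] at h0
      have : 0 < t * (2 * inner ℝ (p - q) u) := by positivity
      linarith
    obtain ⟨y, hy, hy0⟩ := hex
    obtain ⟨τ', -, -, -, -, hτ'0, hτ'prot⟩ :=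
      exists_simplex_of_mem_extremePoints hprot hσP hpσ hy
    exact ⟨y, hy.1, hτ'prot q (hτP hqτ) fun h => hy0 (hτ'0 q h)⟩
  choose! y hyF hy using hvert
  have hyF' := fun r hr => (mem_vorFace_iff hσP hpσ (y r)).1 (hyF r hr)
  have hm : ((τ \ σ).card : ℝ) + 1 = (d : ℝ) - j + 1 := by
    rw [Finset.card_sdiff_of_subset hστ, hτcard, hcard, Nat.cast_sub (by omega)]
    push_cast
    ring
  have hmpos : (0 : ℝ) < ((τ \ σ).card : ℝ) + 1 := by positivity
  have hcF : (((τ \ σ).card : ℝ) + 1)⁻¹ • (x + ∑ r ∈ τ \ σ, y r) ∈ vorFace P ω σ := by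
    refine (mem_vorFace_iff hσP hpσ _).2 ⟨fun q hq => ?_, fun q hq => ?_⟩
    · rw [powerGap_average, hx₀.1 q hq, Finset.sum_eq_zero fun r hr => (hyF' r hr).1 q hq]
      simp
    · rw [powerGap_average]
      exact div_nonneg (add_nonneg (hx₀.2 q hq)
        (Finset.sum_nonneg fun r hr => (hyF' r hr).2 q hq)) hmpos.le
  refine ⟨_, hcF, (powerProtectedAt_iff hσP hpσ hcF _).2 fun q hq hqσ => ?_⟩
  rw [powerGap_average, ← hm]
  refine div_lt_div_of_pos_right ?_ hmpos
  have hnn : ∀ r ∈ τ \ σ, 0 ≤ powerGap ω p q (y r) := fun r hr => (hyF' r hr).2 q hq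
  by_cases hqτ : q ∈ τ
  · have hqm := Finset.mem_sdiff.2 ⟨hqτ, hqσ⟩
    linarith [hy q hqm, hx₀.2 q hq, Finset.single_le_sum hnn hqm]
  · linarith [hτprot q hq hqτ, Finset.sum_nonneg hnn]
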